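/- arXiv:1105.5072 — 6 statements merged into one kernel-verified Lean document; each statement's English description precedes it below -/
import Mathlib

section
/- Let P3 > 0 and let c, d ≥ 0 be real numbers with c + d > 0. Define B(α) = (α/2)·log(1 + P3/(1 + c/α)) + ((1−α)/2)·log(1 + P3/(1 + d/(1−α))) for α ∈ (0,1). Then B is a convex function of α on (0,1). -/
lemma phi_convex (P : ℝ) (hP : 0 < P) :
    ConvexOn ℝ (Set.Ioi (0 : ℝ)) (fun u : ℝ => Real.log (1 + P / u)) := by
  have key : ∀ u ∈ Set.Ioi (0 : ℝ),
      HasDerivAt (fun u : ℝ => Real.log (1 + P / u)) (-(P / (u * (u + P)))) u := by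
    intro u hu
    have hu' : 0 < u := hu
    have hpos : 0 < 1 + P / u := by positivity
    have h := (((hasDerivAt_const u P).div (hasDerivAt_id u) hu'.ne').const_add 1).log hpos.ne'
    refine h.congr_deriv ?_
    simp only [id, Pi.div_apply]
    field_simp
    ring
  apply MonotoneOn.convexOn_of_deriv (convex_Ioi 0)
  · exact fun u hu => (key u hu).continuousAt.continuousWithinAt
  · rw [interior_Ioi]
    exact fun u hu => (key u hu).differentiableAt.differentiableWithinAt
  · rw [interior_Ioi]
    intro u hu v hv huv
    rw [(key u hu).deriv, (key v hv).deriv]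
    have hu' : 0 < u := hu
    have hv' : 0 < v := hv
    apply neg_le_neg
    gcongr

lemma g_ineq (P c : ℝ) (hP : 0 < P) (hc : 0 ≤ c) (x y a b : ℝ) (hx : 0 < x) (hy : 0 < y)
    (ha : 0 ≤ a) (hb : 0 ≤ b) (hab : a + b = 1) :
    (a * x + b * y) * Real.log (1 + P / (1 + c / (a * x + b * y))) ≤
      a * (x * Real.log (1 + P / (1 + c / x))) + b * (y * Real.log (1 + P / (1 + c / y))) := by
  have hz : 0 < a * x + b * y := by
    rcases ha.eq_or_lt with h | h
    · have : b = 1 := by linarith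
      subst h; subst this; linarith
    · positivity
  obtain ⟨z, hzd⟩ : ∃ z, z = a * x + b * y := ⟨_, rfl⟩
  rw [← hzd] at hz ⊢
  have h1 : 0 < 1 + c / x := by positivity
  have h2 : 0 < 1 + c / y := by positivity
  have h := (phi_convex P hP).2 (Set.mem_Ioi.2 h1) (Set.mem_Ioi.2 h2)
    (show 0 ≤ a * x / z by positivity) (show 0 ≤ b * y / z by positivity)
    (by rw [← add_div, ← hzd, div_self hz.ne'])
  simp only [smul_eq_mul] at h
  have e : a * x / z * (1 + c / x) + b * y / z * (1 + c / y) = 1 + c / z := by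
    field_simp
    linear_combination -hzd + c * hab
  rw [e] at h
  have h3 := mul_le_mul_of_nonneg_left h hz.le
  refine h3.trans (le_of_eq ?_)
  field_simp

/-- For P3 > 0 and c, d ≥ 0 with c + d > 0, the function
`B(α) = (α/2)·log(1 + P3/(1 + c/α)) + ((1−α)/2)·log(1 + P3/(1 + d/(1−α)))`
is convex on (0,1). -/
theorem p2p_rate_convex
    (P3 c d : ℝ) (hP3 : 0 < P3) (hc : 0 ≤ c) (hd : 0 ≤ d) (hcd : 0 < c + d) :
    ConvexOn ℝ (Set.Ioo (0 : ℝ) 1)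
      (fun α : ℝ =>
        α / 2 * Real.log (1 + P3 / (1 + c / α))
          + (1 - α) / 2 * Real.log (1 + P3 / (1 + d / (1 - α)))) := by
  refine ⟨convex_Ioo 0 1, ?_⟩
  intro x hx y hy a b ha hb hab
  have h1 := g_ineq P3 c hP3 hc x y a b hx.1 hy.1 ha hb hab
  have h2 := g_ineq P3 d hP3 hd (1 - x) (1 - y) a b (by linarith [hx.2]) (by linarith [hy.2])
    ha hb hab
  have e : a * (1 - x) + b * (1 - y) = 1 - (a * x + b * y) := by linear_combination hab
  rw [e] at h2
  simp only [smul_eq_mul]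
  linarith
end

section
/- Let P3 > 0 and let c, d ≥ 0 with c + d > 0. Define B(α) = (α/2)·log(1 + P3/(1 + c/α)) + ((1−α)/2)·log(1 + P3/(1 + d/(1−α))) for α ∈ (0,1), and set α' = c/(c+d). If α' ∈ (0,1) (i.e., c > 0 and d > 0), then B is differentiable at α' and its derivative at α' equals 0. -/
/-- Derivative of one summand, written in terms of `s = k / x`. -/
lemma hasDerivAt_rate_term (P k x s : ℝ) (hP : 0 < P) (hx : 0 < x) (hs : 0 < s)
    (hk : k / x = s) :
    HasDerivAt (fun α : ℝ => α / 2 * Real.log (1 + P / (1 + k / α)))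
      (1 / 2 * Real.log (1 + P / (1 + s))
        + 1 / 2 * (P * s / (1 + s) ^ 2 / (1 + P / (1 + s)))) x := by
  have hx0 : x ≠ 0 := hx.ne'
  have hkx : k = s * x := by rw [← hk]; field_simp
  have h1 : HasDerivAt (fun α : ℝ => 1 + k / α) ((0 * x - k * 1) / x ^ 2) x :=
    ((hasDerivAt_const x k).div (hasDerivAt_id x) hx0).const_add 1
  have hne : 1 + k / x ≠ 0 := by rw [hk]; positivity
  have h2 := ((hasDerivAt_const x P).div h1 hne).const_add 1
  have hne2 : 1 + P / (1 + k / x) ≠ 0 := by rw [hk]; positivity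
  have h3 := ((hasDerivAt_id x).div_const 2).mul (h2.log hne2)
  refine h3.congr_deriv ?_
  simp only [Pi.div_apply, id, hk]
  subst hkx
  have : 1 + s ≠ 0 := by positivity
  have : 1 + P / (1 + s) ≠ 0 := by positivity
  field_simp
  ring

/-- For P3 > 0 and c, d ≥ 0 with c + d > 0, if α' = c/(c+d) lies
in (0,1), then `B(α) = (α/2)·log(1 + P3/(1 + c/α)) + ((1−α)/2)·log(1 + P3/(1 + d/(1−α)))`
is differentiable at α' with derivative 0. -/
theorem p2p_rate_deriv_zero_at_alpha_prime
    (P3 c d : ℝ) (hP3 : 0 < P3) (hc : 0 ≤ c) (hd : 0 ≤ d) (hcd : 0 < c + d)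
    (hα' : c / (c + d) ∈ Set.Ioo (0 : ℝ) 1) :
    DifferentiableAt ℝ
      (fun α : ℝ =>
        α / 2 * Real.log (1 + P3 / (1 + c / α))
          + (1 - α) / 2 * Real.log (1 + P3 / (1 + d / (1 - α))))
      (c / (c + d))
    ∧ deriv
        (fun α : ℝ =>
          α / 2 * Real.log (1 + P3 / (1 + c / α))
            + (1 - α) / 2 * Real.log (1 + P3 / (1 + d / (1 - α))))
        (c / (c + d)) = 0 := by
  obtain ⟨h0, h1⟩ := hα'
  have hne : c + d ≠ 0 := hcd.ne'
  have hc0 : c ≠ 0 := by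
    rintro rfl
    simp at h0
  have hsub : 1 - c / (c + d) = d / (c + d) := by field_simp; ring
  have hd0 : d ≠ 0 := by
    rintro rfl
    rw [zero_div] at hsub
    linarith
  have hA := hasDerivAt_rate_term P3 c (c / (c + d)) (c + d) hP3 h0 hcd (by field_simp)
  have hB := hasDerivAt_rate_term P3 d (1 - c / (c + d)) (c + d) hP3 (by linarith) hcd
    (by rw [hsub]; field_simp)
  have hC := hB.comp (c / (c + d)) ((hasDerivAt_id (c / (c + d))).const_sub 1)
  have h := (hA.add hC).congr_deriv (g' := 0) (by ring)
  exact ⟨h.differentiableAt, h.deriv⟩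
end

section
/- Let P3 > 0 and let c, d ≥ 0 with c + d > 0. Define B(α) = (α/2)·log(1 + P3/(1 + c/α)) + ((1−α)/2)·log(1 + P3/(1 + d/(1−α))) for α ∈ (0,1). Then for every α ∈ (0,1), B(α) ≥ (1/2)·log(1 + P3/(1 + c + d)); moreover if α' = c/(c+d) lies in (0,1), then B(α') = (1/2)·log(1 + P3/(1 + c + d)), so the minimum of B over (0,1) is attained at α' and equals (1/2)·log(1 + P3/(1 + c + d)). -/
lemma tangent_aux (P x s : ℝ) (hP : 0 < P) (hx : 0 ≤ x) (hs : 0 ≤ s) :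
    Real.log (1 + P / (1 + s)) + P / ((1 + s) * (1 + s + P)) * (s - x)
      ≤ Real.log (1 + P / (1 + x)) := by
  have hx1 : 0 < 1 + x := by linarith
  have hs1 : 0 < 1 + s := by linarith
  have hA : 0 < 1 + P / (1 + x) := by positivity
  have hB : 0 < 1 + P / (1 + s) := by positivity
  have h := Real.one_sub_inv_le_log_of_pos (div_pos hA hB)
  rw [Real.log_div hA.ne' hB.ne'] at h
  have e : 1 - ((1 + P / (1 + x)) / (1 + P / (1 + s)))⁻¹
      - P / ((1 + s) * (1 + s + P)) * (s - x)
      = P * (s - x) ^ 2 / ((1 + s) * (1 + x + P) * (1 + s + P)) := by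
    have h1 : 1 + P / (1 + x) = (1 + x + P) / (1 + x) := by field_simp
    have h2 : 1 + P / (1 + s) = (1 + s + P) / (1 + s) := by field_simp
    have h3 : 1 + x + P ≠ 0 := by positivity
    have h4 : 1 + s + P ≠ 0 := by positivity
    rw [h1, h2]
    field_simp
    ring
  have e2 : 0 ≤ P * (s - x) ^ 2 / ((1 + s) * (1 + x + P) * (1 + s + P)) := by positivity
  linarith

/-- For P3 > 0 and c, d ≥ 0 with c + d > 0, the function
`B(α) = (α/2)·log(1 + P3/(1 + c/α)) + ((1−α)/2)·log(1 + P3/(1 + d/(1−α)))`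
satisfies `B(α) ≥ (1/2)·log(1 + P3/(1 + c + d))` for all α ∈ (0,1); moreover
if α' = c/(c+d) ∈ (0,1) then `B(α') = (1/2)·log(1 + P3/(1 + c + d))`. -/
theorem p2p_rate_min_at_alpha_prime
    (P3 c d : ℝ) (hP3 : 0 < P3) (hc : 0 ≤ c) (hd : 0 ≤ d) (hcd : 0 < c + d) :
    (∀ α ∈ Set.Ioo (0 : ℝ) 1,
      α / 2 * Real.log (1 + P3 / (1 + c / α))
        + (1 - α) / 2 * Real.log (1 + P3 / (1 + d / (1 - α)))
      ≥ 1 / 2 * Real.log (1 + P3 / (1 + c + d)))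
    ∧ (c / (c + d) ∈ Set.Ioo (0 : ℝ) 1 →
      (c / (c + d)) / 2 * Real.log (1 + P3 / (1 + c / (c / (c + d))))
        + (1 - c / (c + d)) / 2
            * Real.log (1 + P3 / (1 + d / (1 - c / (c + d))))
      = 1 / 2 * Real.log (1 + P3 / (1 + c + d))) := by
  refine ⟨?_, ?_⟩
  · rintro α ⟨h0, h1⟩
    have h1' : 0 < 1 - α := by linarith
    have a := tangent_aux P3 (c / α) (c + d) hP3 (by positivity) hcd.le
    have b := tangent_aux P3 (d / (1 - α)) (c + d) hP3 (by positivity) hcd.le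
    have a' := mul_le_mul_of_nonneg_left a (by positivity : 0 ≤ α / 2)
    have b' := mul_le_mul_of_nonneg_left b (by positivity : 0 ≤ (1 - α) / 2)
    rw [add_assoc 1 c d]
    generalize P3 / ((1 + (c + d)) * (1 + (c + d) + P3)) = k at *
    have e : α / 2 * (k * (c + d - c / α)) + (1 - α) / 2 * (k * (c + d - d / (1 - α))) = 0 := by
      have hn : (1 - α) ≠ 0 := h1'.ne'
      field_simp
      ring
    linarith
  · rintro ⟨h0, h1⟩
    have hc' : c ≠ 0 := by
      rintro rfl
      simp at h0
    have hd' : d ≠ 0 := by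
      rintro rfl
      simp [hc'] at h1
    have e0 : 1 - c / (c + d) = d / (c + d) := by
      field_simp
      ring
    have e1 : c / (c / (c + d)) = c + d := by field_simp
    have e2 : d / (d / (c + d)) = c + d := by field_simp
    rw [e0, e1, e2, add_assoc 1 c d, ← add_mul]
    congr 1
    field_simp
end

section
/- Let P1, P2, P3 > 0 and let h12, h22, h31 be real numbers. Set α* = P1/(P1+P2), N1 = 1 + h31²·P3, and define A(α) = (α/2)·log(1 + (P1/α)/N1) + ((1−α)/2)·log(1 + (P2/(1−α))/N1) and B(α) = (α/2)·log(1 + P3/(1 + h12²·P1/α)) + ((1−α)/2)·log(1 + P3/(1 + h22²·P2/(1−α))) for α ∈ (0,1). Then A(α*) + B(α*) ≥ (1/2)·log(1 + (P1+P2)/(1 + h31²·P3)) + (1/2)·log(1 + P3/(1 + h12²·P1 + h22²·P2)). In particular, the supremum over α ∈ (0,1) of A(α) + B(α) (the TDMA-TIN achievable sum-rate) is at least the SD-TIN achievable sum-rate. -/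
theorem log_tangent_aux (P x z : ℝ) (hP : 0 < P) (hx : 0 < x) (hz : 0 < z) :
    Real.log (1 + P / z) + P / (z * (z + P)) * (z - x) ≤ Real.log (1 + P / x) := by
  have hu : 0 < (1 + P / x) / (1 + P / z) := by positivity
  have h1 := Real.one_sub_inv_le_log_of_pos hu
  rw [Real.log_div (by positivity) (by positivity)] at h1
  have h2 : 1 - ((1 + P / x) / (1 + P / z))⁻¹ - P / (z * (z + P)) * (z - x)
      = P * (z - x) ^ 2 / (z * (x + P) * (z + P)) := by
    have : x + P ≠ 0 := by positivity
    have : z + P ≠ 0 := by positivity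
    have e1 : 1 + P / x = (x + P) / x := by field_simp
    have e2 : 1 + P / z = (z + P) / z := by field_simp
    rw [e1, e2]
    field_simp
    ring
  have h3 : 0 ≤ P * (z - x) ^ 2 / (z * (x + P) * (z + P)) := by positivity
  linarith

/-- For P1, P2, P3 > 0 and channel gains h12, h22, h31, with
α* = P1/(P1+P2) and N1 = 1 + h31²·P3, the TDMA-TIN sum-rate A(α*) + B(α*) is
at least the SD-TIN sum-rate
`(1/2)·log(1 + (P1+P2)/(1 + h31²·P3)) + (1/2)·log(1 + P3/(1 + h12²·P1 + h22²·P2))`. -/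
theorem tdma_tin_ge_sd_tin
    (P1 P2 P3 h12 h22 h31 : ℝ) (hP1 : 0 < P1) (hP2 : 0 < P2) (hP3 : 0 < P3) :
    (P1 / (P1 + P2)) / 2
        * Real.log (1 + (P1 / (P1 / (P1 + P2))) / (1 + h31 ^ 2 * P3))
      + (1 - P1 / (P1 + P2)) / 2
        * Real.log (1 + (P2 / (1 - P1 / (P1 + P2))) / (1 + h31 ^ 2 * P3))
      + ((P1 / (P1 + P2)) / 2
          * Real.log (1 + P3 / (1 + h12 ^ 2 * P1 / (P1 / (P1 + P2))))
        + (1 - P1 / (P1 + P2)) / 2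
          * Real.log (1 + P3 / (1 + h22 ^ 2 * P2 / (1 - P1 / (P1 + P2)))))
    ≥ 1 / 2 * Real.log (1 + (P1 + P2) / (1 + h31 ^ 2 * P3))
      + 1 / 2 * Real.log (1 + P3 / (1 + h12 ^ 2 * P1 + h22 ^ 2 * P2)) := by
  have hS : 0 < P1 + P2 := by positivity
  have hb : 1 - P1 / (P1 + P2) = P2 / (P1 + P2) := by field_simp; ring
  have e1 : P1 / (P1 / (P1 + P2)) = P1 + P2 := by field_simp
  have e2 : P2 / (P2 / (P1 + P2)) = P1 + P2 := by field_simp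
  rw [hb, mul_div_assoc, mul_div_assoc, e1, e2]
  have hab : P1 / (P1 + P2) + P2 / (P1 + P2) = 1 := by field_simp
  have ha : 0 < P1 / (P1 + P2) := by positivity
  have hb' : 0 < P2 / (P1 + P2) := by positivity
  have hz : P1 / (P1 + P2) * (1 + h12 ^ 2 * (P1 + P2)) + P2 / (P1 + P2) * (1 + h22 ^ 2 * (P1 + P2))
      = 1 + h12 ^ 2 * P1 + h22 ^ 2 * P2 := by field_simp; ring
  have t1 := log_tangent_aux P3 (1 + h12 ^ 2 * (P1 + P2)) (1 + h12 ^ 2 * P1 + h22 ^ 2 * P2)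
    hP3 (by positivity) (by positivity)
  have t2 := log_tangent_aux P3 (1 + h22 ^ 2 * (P1 + P2)) (1 + h12 ^ 2 * P1 + h22 ^ 2 * P2)
    hP3 (by positivity) (by positivity)
  generalize Real.log (1 + (P1 + P2) / (1 + h31 ^ 2 * P3)) = L at *
  generalize P1 / (P1 + P2) = a at *
  generalize P2 / (P1 + P2) = b at *
  generalize 1 + h12 ^ 2 * P1 + h22 ^ 2 * P2 = z at *
  generalize 1 + h12 ^ 2 * (P1 + P2) = x at *
  generalize 1 + h22 ^ 2 * (P1 + P2) = y at *
  generalize P3 / (z * (z + P3)) = c at *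
  generalize Real.log (1 + P3 / z) = Lz at *
  have m1 := mul_le_mul_of_nonneg_left t1 ha.le
  have m2 := mul_le_mul_of_nonneg_left t2 hb'.le
  obtain rfl : b = 1 - a := by linarith
  subst hz
  linarith
end

section
/- Let P1, P2, P3 > 0 and let h12, h22, h31 be real numbers with h12² ≠ h22² and h12²·P1 + h22²·P2 > 0. Set α* = P1/(P1+P2), N1 = 1 + h31²·P3, and define A(α) = (α/2)·log(1 + (P1/α)/N1) + ((1−α)/2)·log(1 + (P2/(1−α))/N1) and B(α) = (α/2)·log(1 + P3/(1 + h12²·P1/α)) + ((1−α)/2)·log(1 + P3/(1 + h22²·P2/(1−α))) for α ∈ (0,1). Then A(α*) + B(α*) > (1/2)·log(1 + (P1+P2)/(1 + h31²·P3)) + (1/2)·log(1 + P3/(1 + h12²·P1 + h22²·P2)); that is, when h12² ≠ h22² the TDMA-TIN scheme achieves a strictly larger sum-rate than the naive SD-TIN scheme, so SD-TIN is never sum-capacity optimal in that regime. -/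
theorem log_aux (c x z : ℝ) (hc : 0 < c) (hx : 0 < x) (hz : 0 < z) :
    Real.log (1 + c / z) + c / z * ((z - x) / (x + c)) ≤ Real.log (1 + c / x) := by
  have h1 : 0 < 1 + c / z := by positivity
  have h2 : 0 < 1 + c / x := by positivity
  have h := Real.one_sub_inv_le_log_of_pos (div_pos h2 h1)
  rw [Real.log_div h2.ne' h1.ne'] at h
  have e : 1 - ((1 + c / x) / (1 + c / z))⁻¹ = c / z * ((z - x) / (x + c)) := by
    have : x + c ≠ 0 := by positivity
    have : z + c ≠ 0 := by positivity
    have e1 : 1 + c / x = (x + c) / x := by field_simp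
    have e2 : 1 + c / z = (z + c) / z := by field_simp
    rw [e1, e2]
    field_simp
    ring
  linarith

theorem log_jensen (a b c x y : ℝ) (ha : 0 < a) (hb : 0 < b) (hab : a + b = 1) (hc : 0 < c)
    (hx : 0 < x) (hy : 0 < y) (hxy : x ≠ y) :
    Real.log (1 + c / (a * x + b * y)) <
      a * Real.log (1 + c / x) + b * Real.log (1 + c / y) := by
  have hz : 0 < a * x + b * y := by positivity
  have h1 := mul_le_mul_of_nonneg_left (log_aux c x _ hc hx hz) ha.le
  have h2 := mul_le_mul_of_nonneg_left (log_aux c y _ hc hy hz) hb.le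
  obtain rfl : b = 1 - a := by linarith
  set z := a * x + (1 - a) * y with hzd
  have e : a * (c / z * ((z - x) / (x + c))) + (1 - a) * (c / z * ((z - y) / (y + c)))
      = c / z * (a * (1 - a) * (x - y) ^ 2 / ((x + c) * (y + c))) := by
    have : x + c ≠ 0 := by positivity
    have : y + c ≠ 0 := by positivity
    have e1 : z - x = (1 - a) * (y - x) := by rw [hzd]; ring
    have e2 : z - y = a * (x - y) := by rw [hzd]; ring
    rw [e1, e2]
    field_simp
    ring
  have : 0 < (x - y) ^ 2 := by
    have := sub_ne_zero.mpr hxy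
    positivity
  have hp : 0 < c / z * (a * (1 - a) * (x - y) ^ 2 / ((x + c) * (y + c))) := by positivity
  linarith

/-- For P1, P2, P3 > 0 and channel gains with h12² ≠ h22² and
h12²·P1 + h22²·P2 > 0, with α* = P1/(P1+P2), the TDMA-TIN sum-rate
A(α*) + B(α*) is strictly larger than the SD-TIN sum-rate. -/
theorem tdma_tin_gt_sd_tin
    (P1 P2 P3 h12 h22 h31 : ℝ) (hP1 : 0 < P1) (hP2 : 0 < P2) (hP3 : 0 < P3)
    (hne : h12 ^ 2 ≠ h22 ^ 2) (hpos : 0 < h12 ^ 2 * P1 + h22 ^ 2 * P2) :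
    (P1 / (P1 + P2)) / 2
        * Real.log (1 + (P1 / (P1 / (P1 + P2))) / (1 + h31 ^ 2 * P3))
      + (1 - P1 / (P1 + P2)) / 2
        * Real.log (1 + (P2 / (1 - P1 / (P1 + P2))) / (1 + h31 ^ 2 * P3))
      + ((P1 / (P1 + P2)) / 2
          * Real.log (1 + P3 / (1 + h12 ^ 2 * P1 / (P1 / (P1 + P2))))
        + (1 - P1 / (P1 + P2)) / 2
          * Real.log (1 + P3 / (1 + h22 ^ 2 * P2 / (1 - P1 / (P1 + P2)))))
    > 1 / 2 * Real.log (1 + (P1 + P2) / (1 + h31 ^ 2 * P3))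
      + 1 / 2 * Real.log (1 + P3 / (1 + h12 ^ 2 * P1 + h22 ^ 2 * P2)) := by
  have hS : 0 < P1 + P2 := by positivity
  have hb : 1 - P1 / (P1 + P2) = P2 / (P1 + P2) := by field_simp; ring
  have q1 : P1 / (P1 / (P1 + P2)) = P1 + P2 := by field_simp
  have q2 : P2 / (P2 / (P1 + P2)) = P1 + P2 := by field_simp
  rw [hb, mul_div_assoc, mul_div_assoc, q1, q2]
  have hab : P1 / (P1 + P2) + P2 / (P1 + P2) = 1 := by field_simp
  have J := log_jensen (P1 / (P1 + P2)) (P2 / (P1 + P2)) P3 (1 + h12 ^ 2 * (P1 + P2))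
    (1 + h22 ^ 2 * (P1 + P2)) (by positivity) (by positivity) hab hP3
    (by positivity) (by positivity)
    (fun h => hne (mul_right_cancel₀ hS.ne' (add_left_cancel h)))
  have ez : P1 / (P1 + P2) * (1 + h12 ^ 2 * (P1 + P2)) + P2 / (P1 + P2) *
      (1 + h22 ^ 2 * (P1 + P2)) = 1 + h12 ^ 2 * P1 + h22 ^ 2 * P2 := by
    field_simp
    ring
  rw [ez] at J
  have eb : P2 / (P1 + P2) = 1 - P1 / (P1 + P2) := hb.symm
  rw [eb] at J ⊢
  linarith
end

section
/- Let P3 > 0 and c ≥ 0, and define g(α) = (α/2)·log(1 + P3/(1 + c/α)) for α ∈ (0,1). Then g is convex on (0,1), and its one-sided limit as α → 0⁺ is 0. -/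
/-- For P3 > 0 and c ≥ 0, the function
`g(α) = (α/2)·log(1 + P3/(1 + c/α))` is convex on (0,1), and g(α) → 0 as
α → 0⁺. -/
theorem p2p_rate_term_convex_and_tendsto_zero
    (P3 c : ℝ) (hP3 : 0 < P3) (hc : 0 ≤ c) :
    ConvexOn ℝ (Set.Ioo (0 : ℝ) 1)
      (fun α : ℝ => α / 2 * Real.log (1 + P3 / (1 + c / α)))
    ∧ Filter.Tendsto (fun α : ℝ => α / 2 * Real.log (1 + P3 / (1 + c / α)))
        (nhdsWithin 0 (Set.Ioi 0)) (nhds 0) := by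
  constructor
  · have key : ConvexOn ℝ (Set.Ioo (0 : ℝ) 1)
        (fun α : ℝ => α / 2 * (Real.log ((1 + P3) * α + c) - Real.log (α + c))) := by
      have lin : ∀ k x : ℝ, HasDerivAt (fun α : ℝ => k * α + c) k x := by
        intro k x
        simpa using ((hasDerivAt_id x).const_mul k).add_const c
      have lin1 : ∀ x : ℝ, HasDerivAt (fun α : ℝ => α + c) 1 x := by
        intro x
        simpa using (hasDerivAt_id x).add_const c
      refine convexOn_of_hasDerivWithinAt2_nonneg (convex_Ioo 0 1)
        (f' := fun α => 1 / 2 * (Real.log ((1 + P3) * α + c) - Real.log (α + c))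
          + α / 2 * ((1 + P3) / ((1 + P3) * α + c) - 1 / (α + c)))
        (f'' := fun α => 1 / 2 * ((1 + P3) / ((1 + P3) * α + c) - 1 / (α + c))
          + (1 / 2 * ((1 + P3) / ((1 + P3) * α + c) - 1 / (α + c))
          + α / 2 * ((0 * ((1 + P3) * α + c) - (1 + P3) * (1 + P3)) / ((1 + P3) * α + c) ^ 2
            - (0 * (α + c) - 1 * 1) / (α + c) ^ 2))) ?_ ?_ ?_ ?_
      · intro x hx
        have h0 : 0 < x := hx.1
        have h1 : (1 + P3) * x + c ≠ 0 := by positivity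
        have h2 : x + c ≠ 0 := by positivity
        exact ((continuousAt_id.div_const 2).mul
          (((lin _ x).log h1).sub ((lin1 x).log h2)).continuousAt).continuousWithinAt
      · intro x hx
        rw [interior_Ioo] at hx
        have h0 : 0 < x := hx.1
        have h1 : (1 + P3) * x + c ≠ 0 := by positivity
        have h2 : x + c ≠ 0 := by positivity
        exact (((hasDerivAt_id x).div_const 2).mul
          (((lin _ x).log h1).sub ((lin1 x).log h2))).hasDerivWithinAt
      · intro x hx
        rw [interior_Ioo] at hx
        have h0 : 0 < x := hx.1
        have h1 : (1 + P3) * x + c ≠ 0 := by positivity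
        have h2 : x + c ≠ 0 := by positivity
        exact (((((lin _ x).log h1).sub ((lin1 x).log h2)).const_mul (1 / 2)).add
          (((hasDerivAt_id x).div_const 2).mul
          (((hasDerivAt_const x (1 + P3)).div (lin _ x) h1).sub
            ((hasDerivAt_const x (1 : ℝ)).div (lin1 x) h2)))).hasDerivWithinAt
      · intro x hx
        rw [interior_Ioo] at hx
        have h0 : 0 < x := hx.1
        have h1 : 0 < (1 + P3) * x + c := by positivity
        have h2 : 0 < x + c := by positivity
        have e : 1 / 2 * ((1 + P3) / ((1 + P3) * x + c) - 1 / (x + c))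
          + (1 / 2 * ((1 + P3) / ((1 + P3) * x + c) - 1 / (x + c))
          + x / 2 * ((0 * ((1 + P3) * x + c) - (1 + P3) * (1 + P3)) / ((1 + P3) * x + c) ^ 2
            - (0 * (x + c) - 1 * 1) / (x + c) ^ 2))
          = c ^ 2 * P3 * ((2 + P3) * x + 2 * c)
            / (2 * (((1 + P3) * x + c) ^ 2 * (x + c) ^ 2)) := by
          field_simp
          ring
        show 0 ≤ _
        beta_reduce
        rw [e]
        positivity
    refine key.congr ?_
    intro x hx
    have h0 : 0 < x := hx.1
    have h1 : (1 + P3) * x + c ≠ 0 := by positivity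
    have h2 : x + c ≠ 0 := by positivity
    beta_reduce
    rw [← Real.log_div h1 h2]
    congr 2
    field_simp
    ring
  · have hl : Filter.Tendsto (fun α : ℝ => α / 2 * Real.log (1 + P3))
        (nhdsWithin 0 (Set.Ioi 0)) (nhds 0) := by
      have : Continuous (fun α : ℝ => α / 2 * Real.log (1 + P3)) := by fun_prop
      have h := this.tendsto 0
      simp only [zero_div, zero_mul] at h
      exact h.mono_left nhdsWithin_le_nhds
    refine tendsto_of_tendsto_of_tendsto_of_le_of_le' tendsto_const_nhds hl ?_ ?_
    · filter_upwards [self_mem_nhdsWithin] with x hx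
      have h0 : 0 < x := hx
      have : 0 ≤ P3 / (1 + c / x) := by positivity
      have := Real.log_nonneg (show 1 ≤ 1 + P3 / (1 + c / x) by linarith)
      positivity
    · filter_upwards [self_mem_nhdsWithin] with x hx
      have h0 : 0 < x := hx
      have h3 : 0 ≤ c / x := by positivity
      have : P3 / (1 + c / x) ≤ P3 := div_le_self hP3.le (by linarith)
      gcongr
end
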